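/- arXiv:2404.12951 — 5 statements merged into one kernel-verified Lean document; each statement's English description precedes it below -/
import Mathlib

section
/- (Abstract factorization via square factorization systems.) Let (R, →) be an abstract rewriting system and let (→∘ₖ, →•ₖ)_{k∈K} be a square factorization system for (R, →). Then the reduction factorizes: →* ⊆ →∘* ∘ →•*, where →∘ is the union of the →∘ₖ and →• is the union of the →•ₖ, i.e. whenever t →* u there exists s with t →∘* s and s →•* u. -/
open Relation in
/-- If `e` terminates and `i ∘ e ⊆ e⁺ ∘ i*`, then `(e ∪ i)* ⊆ e* ∘ i*`. -/
theorem reflTransGen_or_factorizes_of_terminating {R : Type*} {e i : R → R → Prop}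
    (hterm : ¬ ∃ f : ℕ → R, ∀ n, e (f n) (f (n + 1)))
    (hswap : ∀ a b c, i a b → e b c → ∃ d, TransGen e a d ∧ ReflTransGen i d c)
    {a c : R} (h : ReflTransGen (fun x y => e x y ∨ i x y) a c) :
    ∃ d, ReflTransGen e a d ∧ ReflTransGen i d c := by
  have hwf : WellFounded (flip e) :=
    wellFounded_iff_isEmpty_descending_chain.2 ⟨fun f => hterm ⟨f.1, f.2⟩⟩
  induction a using hwf.induction generalizing c with
  | _ a ih =>
  -- Bring the first `e`-step to the front, then use well-foundedness.
  have key : ∀ b, ReflTransGen i a b → ∀ b' c, e b b' →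
      ReflTransGen (fun x y => e x y ∨ i x y) b' c →
      ∃ d, ReflTransGen e a d ∧ ReflTransGen i d c := by
    intro b hab
    induction hab with
    | refl =>
      intro b' c hb hc
      obtain ⟨d, h₁, h₂⟩ := ih b' hb hc
      exact ⟨d, h₁.head hb, h₂⟩
    | tail _ hi ihn =>
      intro b' c hb hc
      obtain ⟨d, h₁, h₂⟩ := hswap _ _ _ hi hb
      obtain ⟨x, hx, hxd⟩ := TransGen.head'_iff.1 h₁
      exact ihn x c hx ((ReflTransGen.mono (fun _ _ => Or.inl) _ _ hxd).trans
        ((ReflTransGen.mono (fun _ _ => Or.inr) _ _ h₂).trans hc))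
  have split : ∀ b, ReflTransGen (fun x y => e x y ∨ i x y) b c → ReflTransGen i a b →
      ∃ d, ReflTransGen e a d ∧ ReflTransGen i d c := by
    intro b hbc
    induction hbc using ReflTransGen.head_induction_on with
    | refl => exact fun hac => ⟨a, .refl, hac⟩
    | head hxy hyc ihy =>
      intro hax
      rcases hxy with hxy | hxy
      · exact key _ hax _ _ hxy hyc
      · exact ihy (hax.tail hxy)
  exact split a h .refl

/-- **Abstract factorization via square factorization systems.**
Let `(R, r)` be an abstract rewriting system and `(ext k, int k)_{k ∈ K}` a square
factorization system for it: `r` is the union over `k` of `ext k ∪ int k`, each `ext k`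
is terminating, row-swaps `int k ∘ ext k ⊆ (ext k)⁺ ∘ (int k)*` hold, and diagonal-swaps
`int k₁ ∘ ext k₂ ⊆ ext k₂ ∘ (ext k₁ ∪ int k₁)*` hold for `k₁ ≠ k₂`.  Then the reduction
factorizes: whenever `t r* u` there is `s` with `t (⋃ₖ ext k)* s` and `s (⋃ₖ int k)* u`. -/
theorem abstract_factorization {R : Type*} {K : Type*} (r : R → R → Prop)
    (ext int : K → R → R → Prop)
    (hcover : ∀ a b, r a b ↔ ∃ k, ext k a b ∨ int k a b)
    (hterm : ∀ k, ¬ ∃ f : ℕ → R, ∀ n, ext k (f n) (f (n + 1)))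
    (hrow : ∀ k a b c, int k a b → ext k b c →
      ∃ d, Relation.TransGen (ext k) a d ∧ Relation.ReflTransGen (int k) d c)
    (hdiag : ∀ k₁ k₂, k₁ ≠ k₂ → ∀ a b c, int k₁ a b → ext k₂ b c →
      ∃ d, ext k₂ a d ∧
        Relation.ReflTransGen (fun x y => ext k₁ x y ∨ int k₁ x y) d c)
    (t u : R) (h : Relation.ReflTransGen r t u) :
    ∃ s, Relation.ReflTransGen (fun a b => ∃ k, ext k a b) t s ∧
      Relation.ReflTransGen (fun a b => ∃ k, int k a b) s u := by
  have row (k : K) {a c : R} (h : Relation.ReflTransGen (fun x y => ext k x y ∨ int k x y) a c) :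
      ∃ d, Relation.ReflTransGen (ext k) a d ∧ Relation.ReflTransGen (int k) d c :=
    reflTransGen_or_factorizes_of_terminating (hterm k) (hrow k) h
  have to_ext (k : K) {a b : R} (h : Relation.ReflTransGen (ext k) a b) :
      Relation.ReflTransGen (fun a b => ∃ k, ext k a b) a b :=
    Relation.ReflTransGen.mono (fun _ _ h => ⟨k, h⟩) _ _ h
  have diag (k j : K) (hkj : k ≠ j) {a b c : R} (hab : Relation.ReflTransGen (int k) a b)
      (hbc : ext j b c) :
      ∃ d, ext j a d ∧ Relation.ReflTransGen (fun x y => ext k x y ∨ int k x y) d c := by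
    induction hab using Relation.ReflTransGen.head_induction_on with
    | refl => exact ⟨c, hbc, .refl⟩
    | head hxy _ ih =>
      obtain ⟨d, h₁, h₂⟩ := ih
      obtain ⟨d', h₃, h₄⟩ := hdiag k j hkj _ _ _ hxy h₁
      exact ⟨d', h₃, h₄.trans h₂⟩
  have int_ext (k j : K) {a b c : R} (hab : Relation.ReflTransGen (int k) a b)
      (hbc : ext j b c) :
      ∃ d, Relation.ReflTransGen (fun a b => ∃ k, ext k a b) a d ∧
        Relation.ReflTransGen (int k) d c := by
    by_cases hkj : k = j
    · subst hkj
      obtain ⟨d, h₁, h₂⟩ := row k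
        ((Relation.ReflTransGen.mono (fun _ _ => Or.inr) _ _ hab).tail (Or.inl hbc))
      exact ⟨d, to_ext k h₁, h₂⟩
    · obtain ⟨d, h₁, h₂⟩ := diag k j hkj hab hbc
      obtain ⟨d', h₃, h₄⟩ := row k h₂
      exact ⟨d', (to_ext k h₃).head ⟨j, h₁⟩, h₄⟩
  have int_exts (k : K) {a b c : R} (hab : Relation.ReflTransGen (int k) a b)
      (hbc : Relation.ReflTransGen (fun a b => ∃ k, ext k a b) b c) :
      ∃ d, Relation.ReflTransGen (fun a b => ∃ k, ext k a b) a d ∧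
        Relation.ReflTransGen (int k) d c := by
    induction hbc with
    | refl => exact ⟨a, .refl, hab⟩
    | tail _ hstep ih =>
      obtain ⟨d, h₁, h₂⟩ := ih
      obtain ⟨j, hj⟩ := hstep
      obtain ⟨d', h₃, h₄⟩ := int_ext k j h₂ hj
      exact ⟨d', h₁.trans h₃, h₄⟩
  induction h using Relation.ReflTransGen.head_induction_on with
  | refl => exact ⟨u, .refl, .refl⟩
  | head hxy _ ih =>
    obtain ⟨s, h₁, h₂⟩ := ih
    obtain ⟨k, hk | hk⟩ := (hcover _ _).1 hxy
    · exact ⟨s, h₁.head ⟨k, hk⟩, h₂⟩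
    · obtain ⟨d, h₃, h₄⟩ := int_exts k (.single hk) h₁
      exact ⟨d, h₃, (Relation.ReflTransGen.mono (fun _ _ h => ⟨k, h⟩) _ _ h₄).trans h₂⟩
end

section
/- (Abstract diligence.) Let →b, →s, →a be binary relations on a set X such that: (i) →a is terminating; (ii) →a is confluent; (iii) for each R ∈ {→b, →s}, whenever t R u₁ and t →a u₂ there exists w with u₂ R w and u₁ →a* w. Define the diligent reduction →ai as the union of →a with the restrictions of →b and →s to source terms that are →a-normal forms, and let → := →b ∪ →s ∪ →a. Then for all t, u with t →* u and u an →a-normal form, one has t →ai* u. -/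
open Relation in
/-- A relation without infinite sequences reaches a normal form from every element. -/
theorem exists_normalForm_of_terminating {X : Type*} {r : X → X → Prop}
    (hterm : ¬ ∃ f : ℕ → X, ∀ n, r (f n) (f (n + 1))) (t : X) :
    ∃ n, ReflTransGen r t n ∧ ∀ c, ¬ r n c := by
  have hwf : WellFounded (flip r) :=
    wellFounded_iff_isEmpty_descending_chain.mpr ⟨fun f => hterm ⟨f.1, f.2⟩⟩
  induction t using hwf.induction with
  | _ t ih =>
    by_cases ht : ∀ c, ¬ r t c
    · exact ⟨t, .refl, ht⟩
    · push Not at ht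
      obtain ⟨c, hc⟩ := ht
      obtain ⟨n, hcn, hn⟩ := ih c hc
      exact ⟨n, .head hc hcn, hn⟩

open Relation in
/-- A normal form reaches only itself. -/
theorem Relation.ReflTransGen.eq_of_normalForm {X : Type*} {r : X → X → Prop} {n w : X}
    (h : ReflTransGen r n w) (hn : ∀ c, ¬ r n c) : n = w := by
  rcases h.cases_head with h | ⟨c, hc, -⟩
  · exact h
  · exact absurd hc (hn c)

open Relation in
/-- Commutation of an `R`-step with a single `r`-step extends to `r`-reductions. -/
theorem Relation.ReflTransGen.commute_step {X : Type*} {R r : X → X → Prop}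
    (hcomm : ∀ t u₁ u₂, R t u₁ → r t u₂ → ∃ w, R u₂ w ∧ ReflTransGen r u₁ w)
    {t u₁ u₂ : X} (hR : R t u₁) (hr : ReflTransGen r t u₂) :
    ∃ w, R u₂ w ∧ ReflTransGen r u₁ w := by
  induction hr with
  | refl => exact ⟨u₁, hR, .refl⟩
  | tail _ hbc ih =>
    obtain ⟨w, hw, hu₁⟩ := ih
    obtain ⟨w', hw', hww'⟩ := hcomm _ _ _ hw hbc
    exact ⟨w', hw', hu₁.trans hww'⟩

/-- **Abstract diligence.**  Let `rb, rs, ra` be relations on `X` such that `ra` is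
terminating and confluent, and each of `rb, rs` commutes with `ra` in the sense that
`t R u₁` and `t ra u₂` imply `u₂ R w` and `u₁ ra* w` for some `w`.  Let the diligent
reduction be `ra` together with `rb`- and `rs`-steps restricted to `ra`-normal-form
sources.  If `t (rb ∪ rs ∪ ra)* u` and `u` is an `ra`-normal form, then `t` reaches `u`
by diligent steps only. -/
theorem abstract_diligence {X : Type*} (rb rs ra : X → X → Prop)
    (hterm : ¬ ∃ f : ℕ → X, ∀ n, ra (f n) (f (n + 1)))
    (hconf : ∀ t u₁ u₂, Relation.ReflTransGen ra t u₁ → Relation.ReflTransGen ra t u₂ →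
      ∃ w, Relation.ReflTransGen ra u₁ w ∧ Relation.ReflTransGen ra u₂ w)
    (hcomm : ∀ R : X → X → Prop, (R = rb ∨ R = rs) → ∀ t u₁ u₂, R t u₁ → ra t u₂ →
      ∃ w, R u₂ w ∧ Relation.ReflTransGen ra u₁ w)
    (t u : X)
    (h : Relation.ReflTransGen (fun a b => rb a b ∨ rs a b ∨ ra a b) t u)
    (hu : ∀ w, ¬ ra u w) :
    Relation.ReflTransGen
      (fun a b => ra a b ∨ ((rb a b ∨ rs a b) ∧ ∀ c, ¬ ra a c)) t u := by
  have lift {x y : X} (hxy : Relation.ReflTransGen ra x y) : Relation.ReflTransGen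
      (fun a b => ra a b ∨ ((rb a b ∨ rs a b) ∧ ∀ c, ¬ ra a c)) x y :=
    Relation.ReflTransGen.mono (fun _ _ => Or.inl) _ _ hxy
  have comm (x y z : X) (hxy : rb x y ∨ rs x y) (hxz : ra x z) :
      ∃ w, (rb z w ∨ rs z w) ∧ Relation.ReflTransGen ra y w := by
    rcases hxy with hxy | hxy
    · obtain ⟨w, hw, hyw⟩ := hcomm rb (.inl rfl) x y z hxy hxz
      exact ⟨w, .inl hw, hyw⟩
    · obtain ⟨w, hw, hyw⟩ := hcomm rs (.inr rfl) x y z hxy hxz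
      exact ⟨w, .inr hw, hyw⟩
  have main : ∀ n, Relation.ReflTransGen ra t n → (∀ c, ¬ ra n c) → Relation.ReflTransGen
      (fun a b => ra a b ∨ ((rb a b ∨ rs a b) ∧ ∀ c, ¬ ra a c)) n u := by
    induction h using Relation.ReflTransGen.head_induction_on with
    | refl =>
      intro n hun _
      rw [hun.eq_of_normalForm hu]
    | @head v v' hvv' _ ih =>
      intro n hvn hn
      rw [← or_assoc] at hvv'
      rcases hvv' with hvv' | hvv'
      · obtain ⟨w, hnw, hv'w⟩ := Relation.ReflTransGen.commute_step
          (R := fun a b => rb a b ∨ rs a b) comm hvv' hvn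
        obtain ⟨n', hwn', hn'⟩ := exists_normalForm_of_terminating hterm w
        exact .head (.inr ⟨hnw, hn⟩) ((lift hwn').trans (ih n' (hv'w.trans hwn') hn'))
      · obtain ⟨w, hnw, hv'w⟩ := hconf v n v' hvn (.single hvv')
        exact ih n (hnw.eq_of_normalForm hn ▸ hv'w) hn
  obtain ⟨n, htn, hn⟩ := exists_normalForm_of_terminating hterm t
  exact (lift htn).trans (main n htn hn)
end

section
/- (Diligence Process for the distant Bang calculus.) Let t, u be terms of λ!. (Surface) If t →S* u and u is a →S,d!-normal form, then t →Sai* u. (Full) If t →F* u and u is a →F,d!-normal form, then t →Fai* u. -/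
namespace BangPaper

/-! ### Generic rewriting notions -/

/-- `a` is a normal form for the relation `r`. -/
def IsNF {α : Type*} (r : α → α → Prop) (a : α) : Prop := ∀ b, ¬ r a b

/-- Reflexive-transitive closure of the union of two relations,
counting the number of steps of each. -/
inductive Counted2 {α : Type*} (r₁ r₂ : α → α → Prop) : ℕ → ℕ → α → α → Prop
  | refl (t : α) : Counted2 r₁ r₂ 0 0 t t
  | step₁ {t u v : α} {m n : ℕ} :
      r₁ t u → Counted2 r₁ r₂ m n u v → Counted2 r₁ r₂ (m + 1) n t v
  | step₂ {t u v : α} {m n : ℕ} :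
      r₂ t u → Counted2 r₁ r₂ m n u v → Counted2 r₁ r₂ m (n + 1) t v

/-- Reflexive-transitive closure of the union of three relations,
counting the number of steps of each. -/
inductive Counted3 {α : Type*} (r₁ r₂ r₃ : α → α → Prop) : ℕ → ℕ → ℕ → α → α → Prop
  | refl (t : α) : Counted3 r₁ r₂ r₃ 0 0 0 t t
  | step₁ {t u v : α} {m n k : ℕ} :
      r₁ t u → Counted3 r₁ r₂ r₃ m n k u v → Counted3 r₁ r₂ r₃ (m + 1) n k t v
  | step₂ {t u v : α} {m n k : ℕ} :
      r₂ t u → Counted3 r₁ r₂ r₃ m n k u v → Counted3 r₁ r₂ r₃ m (n + 1) k t v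
  | step₃ {t u v : α} {m n k : ℕ} :
      r₃ t u → Counted3 r₁ r₂ r₃ m n k u v → Counted3 r₁ r₂ r₃ m n (k + 1) t v

/-! ### Terms of the distant Bang calculus λ! (de Bruijn representation) -/

/-- Terms of λ!: variables, application, abstraction, bang, dereliction and
explicit substitution (`sub t u` is `t[x←u]`, the binder being in `t`). -/
inductive T : Type
  | var : ℕ → T
  | app : T → T → T
  | lam : T → T
  | bang : T → T
  | der : T → T
  | sub : T → T → T

namespace T

/-- Lift (shift by one) the free de Bruijn variables `≥ k`. -/
def lift (k : ℕ) : T → T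
  | var n => if n < k then var n else var (n + 1)
  | app a b => app (lift k a) (lift k b)
  | lam a => lam (lift (k + 1) a)
  | bang a => bang (lift k a)
  | der a => der (lift k a)
  | sub a b => sub (lift (k + 1) a) (lift k b)

/-- Lift all free variables by `m` (crossing `m` binders). -/
def liftN (m : ℕ) (t : T) : T := (lift 0)^[m] t

/-- Lift all free variables except the first one by `m`
(used to push a term with one distinguished bound variable under `m` extra binders). -/
def liftUnder (m : ℕ) (t : T) : T := (lift 1)^[m] t

/-- Capture-avoiding substitution `t{k := u}` of `u` for de Bruijn variable `k`. -/
def subst : T → ℕ → T → T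
  | var n, k, u => if n < k then var n else if n = k then liftN k u else var (n - 1)
  | app a b, k, u => app (subst a k u) (subst b k u)
  | lam a, k, u => lam (subst a (k + 1) u)
  | bang a, k, u => bang (subst a k u)
  | der a, k, u => der (subst a k u)
  | sub a b, k, u => sub (subst a (k + 1) u) (subst b k u)

/-- The number of constructors (full size) of a term: it counts all
applications, abstractions, explicit substitutions, `!` and `der` occurrences. -/
def size : T → ℕ
  | var _ => 0
  | app a b => 1 + size a + size b
  | lam a => 1 + size a
  | bang a => 1 + size a
  | der a => 1 + size a
  | sub a b => 1 + size a + size b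

end T

/-- Plugging a term into a list context `⟨·⟩[x₁←t₁]…[xₙ←tₙ]`
(represented as the list `[t₁, …, tₙ]`). -/
def fillL : T → List T → T
  | s, [] => s
  | s, t :: L => fillL (T.sub s t) L

/-! ### Rewrite rules of λ! -/

/-- The names of the three rewrite rules of λ!: `dB`, `s!` and `d!`. -/
inductive Rule : Type
  | dB : Rule
  | sBang : Rule
  | dBang : Rule

/-- Root steps of the three rewrite rules of λ! (at a distance, capture-free):
`(dB)  L⟨λx.t⟩ u ↦ L⟨t[x←u]⟩`, `(s!)  t[x←L⟨!u⟩] ↦ L⟨t{x:=u}⟩`,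
`(d!)  der(L⟨!t⟩) ↦ L⟨t⟩`. -/
inductive Root : Rule → T → T → Prop
  | dB (t u : T) (L : List T) :
      Root Rule.dB (T.app (fillL (T.lam t) L) u)
        (fillL (T.sub t (T.liftN L.length u)) L)
  | sBang (t u : T) (L : List T) :
      Root Rule.sBang (T.sub t (fillL (T.bang u) L))
        (fillL (T.subst (T.liftUnder L.length t) 0 u) L)
  | dBang (t : T) (L : List T) :
      Root Rule.dBang (T.der (fillL (T.bang t) L)) (fillL t L)

/-! ### Contexts of λ! -/

/-- (Full) contexts of λ!: terms with exactly one hole, the hole may occur anywhere. -/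
inductive Ctx : Type
  | hole : Ctx
  | appL : Ctx → T → Ctx
  | appR : T → Ctx → Ctx
  | lam : Ctx → Ctx
  | bang : Ctx → Ctx
  | der : Ctx → Ctx
  | subL : Ctx → T → Ctx
  | subR : T → Ctx → Ctx

namespace Ctx

/-- Plugging a term in a context (possibly capturing its free variables). -/
def fill : Ctx → T → T
  | hole, s => s
  | appL C t, s => T.app (fill C s) t
  | appR t C, s => T.app t (fill C s)
  | lam C, s => T.lam (fill C s)
  | bang C, s => T.bang (fill C s)
  | der C, s => T.der (fill C s)
  | subL C t, s => T.sub (fill C s) t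
  | subR t C, s => T.sub t (fill C s)

/-- Surface contexts: the hole does not occur under a `!`. -/
def Surface : Ctx → Prop
  | hole => True
  | appL C _ => Surface C
  | appR _ C => Surface C
  | lam C => Surface C
  | bang _ => False
  | der C => Surface C
  | subL C _ => Surface C
  | subR _ C => Surface C

/-- Internal contexts: the full contexts that are not surface (the hole occurs under a `!`). -/
def Internal (C : Ctx) : Prop := ¬ Surface C

end Ctx

/-! ### Reductions of λ! -/

/-- `StepAt R C t u`: `t` rewrites to `u` by firing a redex of rule `R` under context `C`. -/
def StepAt (R : Rule) (C : Ctx) (t u : T) : Prop :=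
  ∃ a b, Root R a b ∧ t = C.fill a ∧ u = C.fill b

/-- One step of rule `R` under some full context (`→F,R`). -/
def FStepR (R : Rule) (t u : T) : Prop := ∃ C : Ctx, StepAt R C t u

/-- One step of rule `R` under some surface context (`→S,R`). -/
def SStepR (R : Rule) (t u : T) : Prop := ∃ C : Ctx, C.Surface ∧ StepAt R C t u

/-- One step of rule `R` under some internal context (`→I,R`). -/
def IStepR (R : Rule) (t u : T) : Prop := ∃ C : Ctx, C.Internal ∧ StepAt R C t u

/-- Full reduction `→F` of λ!. -/
def FStep (t u : T) : Prop := ∃ R, FStepR R t u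

/-- Surface reduction `→S` of λ!. -/
def SStep (t u : T) : Prop := ∃ R, SStepR R t u

/-- Internal reduction `→I` of λ!. -/
def IStep (t u : T) : Prop := ∃ R, IStepR R t u

/-- Diligent administrative surface reduction `→Sai`: `d!`-surface steps, together with
`dB`- and `s!`-surface steps whose source is a `→S,d!`-normal form. -/
def SaiStep (t u : T) : Prop :=
  SStepR Rule.dBang t u ∨
    ((SStepR Rule.dB t u ∨ SStepR Rule.sBang t u) ∧ IsNF (SStepR Rule.dBang) t)

/-- Diligent administrative full reduction `→Fai`: `d!`-full steps, together with
`dB`- and `s!`-full steps whose source is a `→F,d!`-normal form. -/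
def FaiStep (t u : T) : Prop :=
  FStepR Rule.dBang t u ∨
    ((FStepR Rule.dB t u ∨ FStepR Rule.sBang t u) ∧ IsNF (FStepR Rule.dBang) t)

/-! ### Terms of the CBN / CBV calculi (shared syntax, de Bruijn) -/

/-- Terms of the CBN/CBV calculi: variables, application, abstraction and
explicit substitution (no `!`, no `der`). -/
inductive LT : Type
  | var : ℕ → LT
  | app : LT → LT → LT
  | lam : LT → LT
  | sub : LT → LT → LT

namespace LT

/-- Lift (shift by one) the free de Bruijn variables `≥ k`. -/
def lift (k : ℕ) : LT → LT
  | var n => if n < k then var n else var (n + 1)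
  | app a b => app (lift k a) (lift k b)
  | lam a => lam (lift (k + 1) a)
  | sub a b => sub (lift (k + 1) a) (lift k b)

/-- Lift all free variables by `m`. -/
def liftN (m : ℕ) (t : LT) : LT := (lift 0)^[m] t

/-- Lift all free variables except the first one by `m`. -/
def liftUnder (m : ℕ) (t : LT) : LT := (lift 1)^[m] t

/-- Capture-avoiding substitution `t{k := u}`. -/
def subst : LT → ℕ → LT → LT
  | var n, k, u => if n < k then var n else if n = k then liftN k u else var (n - 1)
  | app a b, k, u => app (subst a k u) (subst b k u)
  | lam a, k, u => lam (subst a (k + 1) u)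
  | sub a b, k, u => sub (subst a (k + 1) u) (subst b k u)

/-- Values: variables and abstractions. -/
def IsValue : LT → Prop
  | var _ => True
  | lam _ => True
  | _ => False

end LT

/-- Plugging a CBN/CBV term into a list context. -/
def fillLN : LT → List LT → LT
  | s, [] => s
  | s, t :: L => fillLN (LT.sub s t) L

/-- The names of the CBN rewrite rules: `dB` and `s`. -/
inductive NRule : Type
  | dB : NRule
  | s : NRule

/-- Root steps of the CBN rules:
`(dB) L⟨λx.t⟩ u ↦ L⟨t[x←u]⟩` and `(s) t[x←u] ↦ t{x:=u}`. -/
inductive NRoot : NRule → LT → LT → Prop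
  | dB (t u : LT) (L : List LT) :
      NRoot NRule.dB (LT.app (fillLN (LT.lam t) L) u)
        (fillLN (LT.sub t (LT.liftN L.length u)) L)
  | s (t u : LT) : NRoot NRule.s (LT.sub t u) (LT.subst t 0 u)

/-- The names of the CBV rewrite rules: `dB` and `sV`. -/
inductive VRule : Type
  | dB : VRule
  | sV : VRule

/-- Root steps of the CBV rules:
`(dB) L⟨λx.t⟩ u ↦ L⟨t[x←u]⟩` and `(sV) t[x←L⟨v⟩] ↦ L⟨t{x:=v}⟩` for `v` a value. -/
inductive VRoot : VRule → LT → LT → Prop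
  | dB (t u : LT) (L : List LT) :
      VRoot VRule.dB (LT.app (fillLN (LT.lam t) L) u)
        (fillLN (LT.sub t (LT.liftN L.length u)) L)
  | sV (t v : LT) (L : List LT) : v.IsValue →
      VRoot VRule.sV (LT.sub t (fillLN v L))
        (fillLN (LT.subst (LT.liftUnder L.length t) 0 v) L)

/-- (Full) contexts of the CBN/CBV calculi. -/
inductive LCtx : Type
  | hole : LCtx
  | appL : LCtx → LT → LCtx
  | appR : LT → LCtx → LCtx
  | lam : LCtx → LCtx
  | subL : LCtx → LT → LCtx
  | subR : LT → LCtx → LCtx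

namespace LCtx

/-- Plugging a term in a CBN/CBV context. -/
def fill : LCtx → LT → LT
  | hole, s => s
  | appL C t, s => LT.app (fill C s) t
  | appR t C, s => LT.app t (fill C s)
  | lam C, s => LT.lam (fill C s)
  | subL C t, s => LT.sub (fill C s) t
  | subR t C, s => LT.sub t (fill C s)

/-- CBN surface contexts: the hole never occurs in the argument of an application
or of an explicit substitution. -/
def NSurface : LCtx → Prop
  | hole => True
  | appL C _ => NSurface C
  | appR _ _ => False
  | lam C => NSurface C
  | subL C _ => NSurface C
  | subR _ _ => False

/-- CBV surface contexts: the hole never occurs under an abstraction. -/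
def VSurface : LCtx → Prop
  | hole => True
  | appL C _ => VSurface C
  | appR _ C => VSurface C
  | lam _ => False
  | subL C _ => VSurface C
  | subR _ C => VSurface C

end LCtx

/-- `NStepAt R C t u`: the CBN step firing rule `R` under context `C`. -/
def NStepAt (R : NRule) (C : LCtx) (t u : LT) : Prop :=
  ∃ a b, NRoot R a b ∧ t = C.fill a ∧ u = C.fill b

/-- `VStepAt R C t u`: the CBV step firing rule `R` under context `C`. -/
def VStepAt (R : VRule) (C : LCtx) (t u : LT) : Prop :=
  ∃ a b, VRoot R a b ∧ t = C.fill a ∧ u = C.fill b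

/-- One CBN step of rule `R` under some full context. -/
def NFStepR (R : NRule) (t u : LT) : Prop := ∃ C : LCtx, NStepAt R C t u

/-- One CBN step of rule `R` under some surface context. -/
def NSStepR (R : NRule) (t u : LT) : Prop := ∃ C : LCtx, C.NSurface ∧ NStepAt R C t u

/-- One CBN step of rule `R` under some internal context. -/
def NIStepR (R : NRule) (t u : LT) : Prop := ∃ C : LCtx, ¬ C.NSurface ∧ NStepAt R C t u

/-- CBN full reduction `→ⁿF`. -/
def NFStep (t u : LT) : Prop := ∃ R, NFStepR R t u

/-- CBN surface reduction `→ⁿS`. -/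
def NSStep (t u : LT) : Prop := ∃ R, NSStepR R t u

/-- CBN internal reduction `→ⁿI`. -/
def NIStep (t u : LT) : Prop := ∃ R, NIStepR R t u

/-- One CBV step of rule `R` under some full context. -/
def VFStepR (R : VRule) (t u : LT) : Prop := ∃ C : LCtx, VStepAt R C t u

/-- One CBV step of rule `R` under some surface context. -/
def VSStepR (R : VRule) (t u : LT) : Prop := ∃ C : LCtx, C.VSurface ∧ VStepAt R C t u

/-- One CBV step of rule `R` under some internal context. -/
def VIStepR (R : VRule) (t u : LT) : Prop := ∃ C : LCtx, ¬ C.VSurface ∧ VStepAt R C t u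

/-- CBV full reduction `→ᵛF`. -/
def VFStep (t u : LT) : Prop := ∃ R, VFStepR R t u

/-- CBV surface reduction `→ᵛS`. -/
def VSStep (t u : LT) : Prop := ∃ R, VSStepR R t u

/-- CBV internal reduction `→ᵛI`. -/
def VIStep (t u : LT) : Prop := ∃ R, VIStepR R t u

/-! ### The CBN embedding into λ! -/

/-- The CBN embedding `(·)ⁿ : xⁿ = x, (λx.t)ⁿ = λx.tⁿ, (t u)ⁿ = tⁿ !(uⁿ),
(t[x←u])ⁿ = tⁿ[x←!(uⁿ)]`. -/
def embN : LT → T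
  | LT.var n => T.var n
  | LT.app t u => T.app (embN t) (T.bang (embN u))
  | LT.lam t => T.lam (embN t)
  | LT.sub t u => T.sub (embN t) (T.bang (embN u))

/-- The CBN embedding extended to contexts, with `⟨·⟩ⁿ = ⟨·⟩`. -/
def embNC : LCtx → Ctx
  | LCtx.hole => Ctx.hole
  | LCtx.appL C t => Ctx.appL (embNC C) (T.bang (embN t))
  | LCtx.appR t C => Ctx.appR (embN t) (Ctx.bang (embNC C))
  | LCtx.lam C => Ctx.lam (embNC C)
  | LCtx.subL C t => Ctx.subL (embNC C) (T.bang (embN t))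
  | LCtx.subR t C => Ctx.subR (embN t) (Ctx.bang (embNC C))

/-- The CBN embedding on rule names: `dBⁿ = dB`, `sⁿ = s!`. -/
def embNRule : NRule → Rule
  | NRule.dB => Rule.dB
  | NRule.s => Rule.sBang

/-! ### The CBV embedding into λ! -/

/-- If `t = L⟨!s⟩` for a list context `L`, return `some L⟨s⟩`, otherwise `none`. -/
def strip? : T → Option T
  | T.bang s => some s
  | T.sub a b => (strip? a).map (fun a' => T.sub a' b)
  | _ => none

/-- The (new) CBV embedding `(·)ᵛ : xᵛ = !x, (λx.t)ᵛ = !λx.!(tᵛ),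
(t u)ᵛ = der(L⟨s⟩ uᵛ)` if `tᵛ = L⟨!s⟩` and `der(der(tᵛ) uᵛ)` otherwise,
`(t[x←u])ᵛ = tᵛ[x←uᵛ]`. -/
def embV : LT → T
  | LT.var n => T.bang (T.var n)
  | LT.lam t => T.bang (T.lam (T.bang (embV t)))
  | LT.app t u =>
      match strip? (embV t) with
      | some s => T.der (T.app s (embV u))
      | none => T.der (T.app (T.der (embV t)) (embV u))
  | LT.sub t u => T.sub (embV t) (embV u)

/-- The CBV embedding on rule names: `dBᵛ = dB`, `sVᵛ = s!`. -/
def embVRule : VRule → Rule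
  | VRule.dB => Rule.dB
  | VRule.sV => Rule.sBang

/-! ### Inductive presentation of the rewrite rules -/

/-- `Strip a c`: `a = L⟨!s⟩` and `c = L⟨s⟩`. -/
inductive Strip : T → T → Prop
  | bang (s : T) : Strip (T.bang s) s
  | sub {a c : T} (b : T) : Strip a c → Strip (T.sub a b) (T.sub c b)

/-- `Beta a u c`: the application `a u` is a `dB`-redex with reduct `c`. -/
inductive Beta : T → T → T → Prop
  | lam (t u : T) : Beta (T.lam t) u (T.sub t u)
  | sub {a u c : T} (b : T) : Beta a (T.lift 0 u) c → Beta (T.sub a b) u (T.sub c b)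

/-- `Subst t p c`: the explicit substitution of `p` in `t` is an `s!`-redex with reduct `c`. -/
inductive Subst : T → T → T → Prop
  | bang (t u : T) : Subst t (T.bang u) (T.subst t 0 u)
  | sub {t a c : T} (b : T) : Subst (T.lift 1 t) a c → Subst t (T.sub a b) (T.sub c b)

/-- One step of a rule, where reduction under `!` is allowed exactly when `f` holds. -/
inductive Step (f : Prop) : Rule → T → T → Prop
  | strip {a c : T} : Strip a c → Step f Rule.dBang (T.der a) c
  | beta {a u c : T} : Beta a u c → Step f Rule.dB (T.app a u) c
  | subst {t p c : T} : Subst t p c → Step f Rule.sBang (T.sub t p) c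
  | appL {R : Rule} {a a' : T} (b : T) : Step f R a a' → Step f R (T.app a b) (T.app a' b)
  | appR {R : Rule} {b b' : T} (a : T) : Step f R b b' → Step f R (T.app a b) (T.app a b')
  | lam {R : Rule} {a a' : T} : Step f R a a' → Step f R (T.lam a) (T.lam a')
  | bang {R : Rule} {a a' : T} : f → Step f R a a' → Step f R (T.bang a) (T.bang a')
  | der {R : Rule} {a a' : T} : Step f R a a' → Step f R (T.der a) (T.der a')
  | subL {R : Rule} {a a' : T} (b : T) : Step f R a a' → Step f R (T.sub a b) (T.sub a' b)
  | subR {R : Rule} {b b' : T} (a : T) : Step f R b b' → Step f R (T.sub a b) (T.sub a b')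

/-! ### Equivalence of the two presentations -/

theorem fillL_append_singleton (s b : T) (L : List T) :
    fillL s (L ++ [b]) = T.sub (fillL s L) b := by
  induction L generalizing s with
  | nil => rfl
  | cons a L ih => exact ih _

theorem Strip.fillL (s : T) (L : List T) : Strip (fillL (T.bang s) L) (fillL s L) := by
  induction L using List.reverseRecOn with
  | nil => exact .bang s
  | append_singleton L b ih =>
    simp only [fillL_append_singleton]
    exact .sub b ih

theorem Beta.fillL (t u : T) (L : List T) :
    Beta (fillL (T.lam t) L) u (fillL (T.sub t (T.liftN L.length u)) L) := by
  induction L using List.reverseRecOn generalizing u with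
  | nil => exact .lam t u
  | append_singleton L b ih =>
    simp only [fillL_append_singleton, List.length_append, List.length_singleton]
    exact .sub b (ih _)

theorem Subst.fillL (t u : T) (L : List T) :
    Subst t (fillL (T.bang u) L) (fillL (T.subst (T.liftUnder L.length t) 0 u) L) := by
  induction L using List.reverseRecOn generalizing t with
  | nil => exact .bang t u
  | append_singleton L b ih =>
    simp only [fillL_append_singleton, List.length_append, List.length_singleton]
    exact .sub b (ih _)

theorem Strip.exists_fillL {a c : T} (h : Strip a c) :
    ∃ s L, a = BangPaper.fillL (T.bang s) L ∧ c = BangPaper.fillL s L := by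
  induction h with
  | bang s => exact ⟨s, [], rfl, rfl⟩
  | sub b _ ih =>
    obtain ⟨s, L, rfl, rfl⟩ := ih
    exact ⟨s, L ++ [b], by simp only [fillL_append_singleton],
      by simp only [fillL_append_singleton]⟩

theorem Beta.exists_fillL {a u c : T} (h : Beta a u c) :
    ∃ t L, a = BangPaper.fillL (T.lam t) L ∧
      c = BangPaper.fillL (T.sub t (T.liftN L.length u)) L := by
  induction h with
  | lam t u => exact ⟨t, [], rfl, rfl⟩
  | sub b _ ih =>
    obtain ⟨t, L, rfl, rfl⟩ := ih
    refine ⟨t, L ++ [b], by simp only [fillL_append_singleton], ?_⟩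
    simp only [fillL_append_singleton, List.length_append, List.length_singleton]
    rfl

theorem Subst.exists_fillL {t p c : T} (h : Subst t p c) :
    ∃ u L, p = BangPaper.fillL (T.bang u) L ∧
      c = BangPaper.fillL (T.subst (T.liftUnder L.length t) 0 u) L := by
  induction h with
  | bang t u => exact ⟨u, [], rfl, rfl⟩
  | sub b _ ih =>
    obtain ⟨u, L, rfl, rfl⟩ := ih
    refine ⟨u, L ++ [b], by simp only [fillL_append_singleton], ?_⟩
    simp only [fillL_append_singleton, List.length_append, List.length_singleton]
    rfl

theorem Root.step {f : Prop} {R : Rule} {a b : T} (h : Root R a b) : Step f R a b := by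
  cases h with
  | dB t u L => exact .beta (Beta.fillL t u L)
  | sBang t u L => exact .subst (Subst.fillL t u L)
  | dBang t L => exact .strip (Strip.fillL t L)

theorem Step.fill {f : Prop} {R : Rule} {a b : T} (h : Step f R a b) (C : Ctx)
    (hC : f ∨ C.Surface) : Step f R (C.fill a) (C.fill b) := by
  induction C with
  | hole => exact h
  | appL C t ih => exact .appL t (ih hC)
  | appR t C ih => exact .appR t (ih hC)
  | lam C ih => exact .lam (ih hC)
  | bang C ih =>
    have hf : f := hC.resolve_right id
    exact .bang hf (ih (.inl hf))
  | der C ih => exact .der (ih hC)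
  | subL C t ih => exact .subL t (ih hC)
  | subR t C ih => exact .subR t (ih hC)

theorem step_iff {f : Prop} {R : Rule} {t u : T} :
    Step f R t u ↔ ∃ C : Ctx, (f ∨ C.Surface) ∧ StepAt R C t u := by
  constructor
  · intro h
    induction h with
    | strip h =>
      obtain ⟨s, L, rfl, rfl⟩ := h.exists_fillL
      exact ⟨.hole, .inr trivial, _, _, .dBang s L, rfl, rfl⟩
    | beta h =>
      obtain ⟨t, L, rfl, rfl⟩ := h.exists_fillL
      exact ⟨.hole, .inr trivial, _, _, .dB t _ L, rfl, rfl⟩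
    | subst h =>
      obtain ⟨u, L, rfl, rfl⟩ := h.exists_fillL
      exact ⟨.hole, .inr trivial, _, _, .sBang _ u L, rfl, rfl⟩
    | appL b _ ih =>
      obtain ⟨C, hC, a, c, h, rfl, rfl⟩ := ih
      exact ⟨.appL C b, hC, a, c, h, rfl, rfl⟩
    | appR b _ ih =>
      obtain ⟨C, hC, a, c, h, rfl, rfl⟩ := ih
      exact ⟨.appR b C, hC, a, c, h, rfl, rfl⟩
    | lam _ ih =>
      obtain ⟨C, hC, a, c, h, rfl, rfl⟩ := ih
      exact ⟨.lam C, hC, a, c, h, rfl, rfl⟩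
    | bang hf _ ih =>
      obtain ⟨C, hC, a, c, h, rfl, rfl⟩ := ih
      exact ⟨.bang C, .inl hf, a, c, h, rfl, rfl⟩
    | der _ ih =>
      obtain ⟨C, hC, a, c, h, rfl, rfl⟩ := ih
      exact ⟨.der C, hC, a, c, h, rfl, rfl⟩
    | subL b _ ih =>
      obtain ⟨C, hC, a, c, h, rfl, rfl⟩ := ih
      exact ⟨.subL C b, hC, a, c, h, rfl, rfl⟩
    | subR b _ ih =>
      obtain ⟨C, hC, a, c, h, rfl, rfl⟩ := ih
      exact ⟨.subR b C, hC, a, c, h, rfl, rfl⟩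
  · rintro ⟨C, hC, a, b, h, rfl, rfl⟩
    exact h.step.fill C hC

theorem step_false : Step False = SStepR := by
  funext R t u
  simp [step_iff, SStepR]

theorem step_true : Step True = FStepR := by
  funext R t u
  simp [step_iff, FStepR]

/-! ### Stability of `d!`-steps under lifting and substitution -/

theorem Strip.unique {a c d : T} (h : Strip a c) (h' : Strip a d) : c = d := by
  induction h generalizing d with
  | bang s => cases h'; rfl
  | sub b _ ih =>
    cases h' with
    | sub _ h' => rw [ih h']

theorem Strip.size_lt {a c : T} (h : Strip a c) : c.size < a.size := by
  induction h with
  | bang s => simp only [T.size]; omega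
  | sub b _ ih => simp only [T.size]; omega

theorem Strip.lift {a c : T} (h : Strip a c) (k : ℕ) : Strip (a.lift k) (c.lift k) := by
  induction h generalizing k with
  | bang s => exact .bang _
  | sub b _ ih => exact .sub _ (ih _)

theorem Strip.substitute {a c : T} (h : Strip a c) (k : ℕ) (u : T) :
    Strip (a.subst k u) (c.subst k u) := by
  induction h generalizing k with
  | bang s => exact .bang _
  | sub b _ ih => exact .sub _ (ih _)

/-- `d!`-steps, where reduction under `!` is allowed exactly when `f` holds. -/
abbrev DStep (f : Prop) : T → T → Prop := Step f Rule.dBang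

section

variable {f : Prop}

theorem Step.size_lt {t u : T} (h : Step f Rule.dBang t u) : u.size < t.size := by
  generalize hR : Rule.dBang = R at h
  induction h with
  | strip h => have := h.size_lt; simp only [T.size]; omega
  | beta h => cases hR
  | subst h => cases hR
  | _ => simp only [T.size]; grind

theorem Step.lift {t u : T} (h : Step f Rule.dBang t u) (k : ℕ) : DStep f (t.lift k) (u.lift k) := by
  generalize hR : Rule.dBang = R at h
  induction h generalizing k with
  | strip h => exact .strip (h.lift k)
  | beta h => cases hR
  | subst h => cases hR
  | appL b _ ih => exact .appL _ (ih _ hR)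
  | appR b _ ih => exact .appR _ (ih _ hR)
  | lam _ ih => exact .lam (ih _ hR)
  | bang hf _ ih => exact .bang hf (ih _ hR)
  | der _ ih => exact .der (ih _ hR)
  | subL b _ ih => exact .subL _ (ih _ hR)
  | subR b _ ih => exact .subR _ (ih _ hR)

theorem Step.liftN {t u : T} (h : DStep f t u) (k : ℕ) : DStep f (t.liftN k) (u.liftN k) := by
  induction k generalizing t u with
  | zero => exact h
  | succ k ih => exact ih (h.lift 0)

theorem Step.subst_left {t t' : T} (h : Step f Rule.dBang t t') (k : ℕ) (u : T) :
    DStep f (t.subst k u) (t'.subst k u) := by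
  generalize hR : Rule.dBang = R at h
  induction h generalizing k with
  | strip h => exact .strip (h.substitute k u)
  | beta h => cases hR
  | subst h => cases hR
  | appL b _ ih => exact .appL _ (ih _ hR)
  | appR b _ ih => exact .appR _ (ih _ hR)
  | lam _ ih => exact .lam (ih _ hR)
  | bang hf _ ih => exact .bang hf (ih _ hR)
  | der _ ih => exact .der (ih _ hR)
  | subL b _ ih => exact .subL _ (ih _ hR)
  | subR b _ ih => exact .subR _ (ih _ hR)

open Relation

theorem Step.subst_right (hf : f) {u u' : T} (h : DStep f u u') (t : T) (k : ℕ) :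
    ReflTransGen (DStep f) (t.subst k u) (t.subst k u') := by
  induction t generalizing k with
  | var n =>
    simp only [T.subst]
    split_ifs
    · exact .refl
    · exact .single (h.liftN k)
    · exact .refl
  | app a b iha ihb =>
    exact ((iha k).lift (T.app · _) fun _ _ h => .appL _ h).trans
      ((ihb k).lift (T.app _ ·) fun _ _ h => .appR _ h)
  | lam a ih => exact (ih _).lift T.lam fun _ _ h => .lam h
  | bang a ih => exact (ih _).lift T.bang fun _ _ h => .bang hf h
  | der a ih => exact (ih _).lift T.der fun _ _ h => .der h
  | sub a b iha ihb =>
    exact ((iha _).lift (T.sub · _) fun _ _ h => .subL _ h).trans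
      ((ihb k).lift (T.sub _ ·) fun _ _ h => .subR _ h)

/-! ### Commutation of redexes with `d!`-steps -/

theorem Beta.dStep_left {a u c a' : T} (h : Beta a u c) (ha : DStep f a a') :
    ∃ c', Beta a' u c' ∧ DStep f c c' := by
  induction h generalizing a' with
  | lam t u =>
    cases ha with
    | lam ha => exact ⟨_, .lam _ _, .subL _ ha⟩
  | sub b h ih =>
    cases ha with
    | subL _ ha =>
      obtain ⟨c', h, hc⟩ := ih ha
      exact ⟨_, .sub b h, .subL _ hc⟩
    | subR _ hb => exact ⟨_, .sub _ h, .subR _ hb⟩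

theorem Beta.dStep_right {a u c u' : T} (h : Beta a u c) (hu : DStep f u u') :
    ∃ c', Beta a u' c' ∧ DStep f c c' := by
  induction h generalizing u' with
  | lam t u => exact ⟨_, .lam _ _, .subR _ hu⟩
  | sub b h ih =>
    obtain ⟨c', h, hc⟩ := ih (hu.lift 0)
    exact ⟨_, .sub b h, .subL _ hc⟩

theorem Subst.dStep_left {t p c t' : T} (h : Subst t p c) (ht : DStep f t t') :
    ∃ c', Subst t' p c' ∧ DStep f c c' := by
  induction h generalizing t' with
  | bang t u => exact ⟨_, .bang _ _, ht.subst_left 0 u⟩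
  | sub b h ih =>
    obtain ⟨c', h, hc⟩ := ih (ht.lift 1)
    exact ⟨_, .sub b h, .subL _ hc⟩

theorem Subst.dStep_right {t p c p' : T} (h : Subst t p c) (hp : DStep f p p') :
    ∃ c', Subst t p' c' ∧ ReflTransGen (DStep f) c c' := by
  induction h generalizing p' with
  | bang t u =>
    cases hp with
    | bang hf hu => exact ⟨_, .bang _ _, hu.subst_right hf t 0⟩
  | sub b h ih =>
    cases hp with
    | subL _ ha =>
      obtain ⟨c', h, hc⟩ := ih ha
      exact ⟨_, .sub b h, hc.lift (T.sub · b) fun _ _ h => .subL _ h⟩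
    | subR _ hb => exact ⟨_, .sub _ h, .single (.subR _ hb)⟩

theorem Subst.strip {t p d t' : T} (h : Subst t p d) (ht : Strip t t') :
    ∃ d', Subst t' p d' ∧ Strip d d' := by
  induction h generalizing t' with
  | bang t u => exact ⟨_, .bang _ _, ht.substitute 0 u⟩
  | sub b h ih =>
    obtain ⟨d', h, hd⟩ := ih (ht.lift 1)
    exact ⟨_, .sub b h, .sub _ hd⟩

theorem Strip.step {R : Rule} {a c a' : T} (h : Strip a c) (ha : Step f R a a') :
    ∃ c', Strip a' c' ∧ Step f R c c' := by
  induction h generalizing a' with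
  | bang s =>
    cases ha with
    | bang _ hs => exact ⟨_, .bang _, hs⟩
  | sub b h ih =>
    cases ha with
    | subst hs =>
      obtain ⟨d', hs, hd⟩ := hs.strip h
      exact ⟨d', hd, .subst hs⟩
    | subL _ ha =>
      obtain ⟨c', h, hc⟩ := ih ha
      exact ⟨_, .sub b h, .subL _ hc⟩
    | subR _ hb => exact ⟨_, .sub _ h, .subR _ hb⟩

/-- `Joinable f R u t'`: `t'` reaches by one `R`-step (or none, if `R` is `d!`) a `d!`-reduct
of `u`. -/
def Joinable (f : Prop) (R : Rule) (u t' : T) : Prop :=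
  ∃ v, (Step f R t' v ∨ R = Rule.dBang ∧ t' = v) ∧ ReflTransGen (DStep f) u v

theorem Joinable.map {R : Rule} {u t' : T} (h : Joinable f R u t') (g : T → T)
    (hg : ∀ (R : Rule) (a b : T), Step f R a b → Step f R (g a) (g b)) :
    Joinable f R (g u) (g t') := by
  obtain ⟨v, hv, huv⟩ := h
  exact ⟨g v, hv.imp (hg _ _ _) fun ⟨hR, e⟩ => ⟨hR, congrArg g e⟩, huv.lift g (hg _)⟩

theorem Step.joinable {R : Rule} {t u t' : T} (h : Step f R t u) (h' : DStep f t t') :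
    Joinable f R u t' := by
  induction h generalizing t' with
  | strip h =>
    cases h' with
    | strip h' => exact ⟨_, .inr ⟨rfl, rfl⟩, (h.unique h') ▸ .refl⟩
    | der h' =>
      obtain ⟨c', hs, hc⟩ := h.step h'
      exact ⟨c', .inl (.strip hs), .single hc⟩
  | beta h =>
    cases h' with
    | appL _ h' =>
      obtain ⟨c', h, hc⟩ := h.dStep_left h'
      exact ⟨c', .inl (.beta h), .single hc⟩
    | appR _ h' =>
      obtain ⟨c', h, hc⟩ := h.dStep_right h'
      exact ⟨c', .inl (.beta h), .single hc⟩
  | subst h =>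
    cases h' with
    | subL _ h' =>
      obtain ⟨c', h, hc⟩ := h.dStep_left h'
      exact ⟨c', .inl (.subst h), .single hc⟩
    | subR _ h' =>
      obtain ⟨c', h, hc⟩ := h.dStep_right h'
      exact ⟨c', .inl (.subst h), hc⟩
  | appL b h ih =>
    cases h' with
    | appL _ h' => exact (ih h').map (T.app · b) fun _ _ _ h => .appL _ h
    | appR _ h' => exact ⟨_, .inl (.appL _ h), .single (.appR _ h')⟩
  | appR a h ih =>
    cases h' with
    | appR _ h' => exact (ih h').map (T.app a ·) fun _ _ _ h => .appR _ h
    | appL _ h' => exact ⟨_, .inl (.appR _ h), .single (.appL _ h')⟩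
  | lam h ih =>
    cases h' with
    | lam h' => exact (ih h').map T.lam fun _ _ _ h => .lam h
  | bang hf h ih =>
    cases h' with
    | bang _ h' => exact (ih h').map T.bang fun _ _ _ h => .bang hf h
  | der h ih =>
    cases h' with
    | strip h' =>
      obtain ⟨c', hs, hc⟩ := h'.step h
      exact ⟨c', .inl hc, .single (.strip hs)⟩
    | der h' => exact (ih h').map T.der fun _ _ _ h => .der h
  | subL b h ih =>
    cases h' with
    | subL _ h' => exact (ih h').map (T.sub · b) fun _ _ _ h => .subL _ h
    | subR _ h' => exact ⟨_, .inl (.subL _ h), .single (.subR _ h')⟩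
  | subR a h ih =>
    cases h' with
    | subR _ h' => exact (ih h').map (T.sub a ·) fun _ _ _ h => .subR _ h
    | subL _ h' => exact ⟨_, .inl (.subR _ h), .single (.subL _ h')⟩

/-! ### The diligence process -/

theorem Step.confluent {t a b : T} (ha : ReflTransGen (DStep f) t a)
    (hb : ReflTransGen (DStep f) t b) : Join (ReflTransGen (DStep f)) a b := by
  refine church_rosser (fun t u t' h h' => ?_) ha hb
  obtain ⟨v, hv | ⟨_, rfl⟩, huv⟩ := h'.joinable h
  · exact ⟨v, .single hv, huv⟩
  · exact ⟨u, .refl, huv⟩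

theorem Step.exists_nf (t : T) : ∃ n, ReflTransGen (DStep f) t n ∧ IsNF (DStep f) n := by
  induction hs : t.size using Nat.strong_induction_on generalizing t with
  | _ m ih =>
    by_cases hn : IsNF (DStep f) t
    · exact ⟨t, .refl, hn⟩
    · simp only [IsNF, not_forall, not_not] at hn
      obtain ⟨u, hu⟩ := hn
      obtain ⟨n, hun, hn⟩ := ih _ (hs ▸ hu.size_lt) u rfl
      exact ⟨n, .head hu hun, hn⟩

theorem Step.commute_dStep {R : Rule} (hR : R ≠ Rule.dBang) {t u t' : T} (h : Step f R t u)
    (h' : ReflTransGen (DStep f) t t') :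
    ∃ v, Step f R t' v ∧ ReflTransGen (DStep f) u v := by
  induction h' with
  | refl => exact ⟨u, h, .refl⟩
  | tail _ hs ih =>
    obtain ⟨v, hv, huv⟩ := ih
    obtain ⟨w, hw, hvw⟩ := hv.joinable hs
    exact ⟨w, hw.resolve_right fun e => hR e.1, huv.trans hvw⟩

/-- Administrative steps: `d!`-steps, and other steps from `d!`-normal forms. -/
def AiStep (f : Prop) (t u : T) : Prop :=
  DStep f t u ∨ (Step f Rule.dB t u ∨ Step f Rule.sBang t u) ∧ IsNF (DStep f) t

theorem reflTransGen_aiStep {t u : T}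
    (h : ReflTransGen (fun a b => ∃ R, Step f R a b) t u) (hu : IsNF (DStep f) u) {t' : T}
    (h' : ReflTransGen (DStep f) t t') : ReflTransGen (AiStep f) t' u := by
  have hD {a b : T} (h : ReflTransGen (DStep f) a b) : ReflTransGen (AiStep f) a b :=
    ReflTransGen.mono (fun _ _ => .inl) _ _ h
  induction h using ReflTransGen.head_induction_on generalizing t' with
  | refl =>
    obtain rfl | ⟨c, hc, _⟩ := h'.cases_head
    · exact .refl
    · exact absurd hc (hu c)
  | head hs _ ih =>
    obtain ⟨R, hs⟩ := hs
    by_cases hR : R = Rule.dBang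
    · subst hR
      obtain ⟨s, hs₁, hs₂⟩ := Step.confluent h' (.single hs)
      exact (hD hs₁).trans (ih hs₂)
    · obtain ⟨n, hn, hnf⟩ := Step.exists_nf (f := f) t'
      obtain ⟨v, hv, hwv⟩ := hs.commute_dStep hR (h'.trans hn)
      refine (hD hn).trans (.head (.inr ⟨?_, hnf⟩) (ih hwv))
      cases R with
      | dB => exact .inl hv
      | sBang => exact .inr hv
      | dBang => exact absurd rfl hR

end

/-- **Diligence Process for the distant Bang calculus λ!.**
(Surface) If `t →S* u` and `u` is a `→S,d!`-normal form, then `t →Sai* u`.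
(Full) If `t →F* u` and `u` is a `→F,d!`-normal form, then `t →Fai* u`. -/
theorem diligence_process (t u : T) :
    (Relation.ReflTransGen SStep t u → IsNF (SStepR Rule.dBang) u →
      Relation.ReflTransGen SaiStep t u) ∧
    (Relation.ReflTransGen FStep t u → IsNF (FStepR Rule.dBang) u →
      Relation.ReflTransGen FaiStep t u) := by
  constructor
  · intro h hu
    rw [← step_false] at hu
    have h : Relation.ReflTransGen (AiStep False) t u :=
      reflTransGen_aiStep (by rwa [step_false]) hu .refl
    unfold AiStep DStep at h
    rwa [step_false] at h
  · intro h hu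
    rw [← step_true] at hu
    have h : Relation.ReflTransGen (AiStep True) t u :=
      reflTransGen_aiStep (by rwa [step_true]) hu .refl
    unfold AiStep DStep at h
    rwa [step_true] at h

end BangPaper
end

section
/- (CBN one-step simulation.) Let t, u be CBN terms, N a CBN full context and R ∈ {dB, s}. If t →ⁿF u by firing rule R under context N (i.e. t = N⟨t'⟩, u = N⟨u'⟩ with t' ↦R u'), then tⁿ reduces to uⁿ in one →F-step of λ!, namely by firing the rule Rⁿ under the context Nⁿ. -/
namespace BangPaper

/-! ### Compatibility of the CBN embedding with the syntactic operations -/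

theorem embN_lift (t : LT) (k : ℕ) : embN (t.lift k) = (embN t).lift k := by
  induction t generalizing k with
  | var n => simp only [LT.lift, embN, T.lift]; split_ifs <;> rfl
  | app a b iha ihb => simp only [LT.lift, embN, T.lift, iha, ihb]
  | lam a iha => simp only [LT.lift, embN, T.lift, iha]
  | sub a b iha ihb => simp only [LT.lift, embN, T.lift, iha, ihb]

theorem embN_liftN (m : ℕ) (t : LT) : embN (t.liftN m) = (embN t).liftN m :=
  Function.Semiconj.iterate_right (fun s => embN_lift s 0) m t

theorem embN_subst (t : LT) (k : ℕ) (u : LT) :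
    embN (t.subst k u) = (embN t).subst k (embN u) := by
  induction t generalizing k with
  | var n =>
    simp only [LT.subst, embN, T.subst]
    split_ifs
    · rfl
    · exact embN_liftN k u
    · rfl
  | app a b iha ihb => simp only [LT.subst, embN, T.subst, iha, ihb]
  | lam a iha => simp only [LT.subst, embN, T.subst, iha]
  | sub a b iha ihb => simp only [LT.subst, embN, T.subst, iha, ihb]

theorem T.liftN_bang (m : ℕ) (t : T) : (T.bang t).liftN m = T.bang (t.liftN m) :=
  ((show Function.Semiconj T.bang (T.lift 0) (T.lift 0) from fun _ => rfl).iterate_right m t).symm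

theorem embN_fillLN (s : LT) (L : List LT) :
    embN (fillLN s L) = fillL (embN s) (L.map fun t => T.bang (embN t)) := by
  induction L generalizing s with
  | nil => rfl
  | cons t L ih => exact ih (LT.sub s t)

theorem embN_fill (N : LCtx) (s : LT) : embN (N.fill s) = (embNC N).fill (embN s) := by
  induction N <;> simp_all only [LCtx.fill, embN, embNC, Ctx.fill]

/-- The CBN embedding maps root steps to root steps. -/
theorem embN_root {R : NRule} {a b : LT} (h : NRoot R a b) :
    Root (embNRule R) (embN a) (embN b) := by
  cases h with
  | dB t u L =>
    have key := Root.dB (embN t) (T.bang (embN u))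
      (L.map fun t => T.bang (embN t))
    rw [List.length_map, T.liftN_bang, ← embN_liftN] at key
    simpa only [embNRule, embN, embN_fillLN] using key
  | s t u =>
    rw [embN_subst]
    exact Root.sBang (embN t) (embN u) []

/-- **CBN one-step simulation.**  If `t →ⁿF u` by firing rule `R ∈ {dB, s}` under the
CBN full context `N`, then `tⁿ` reduces to `uⁿ` in one `→F`-step of λ!, firing
rule `Rⁿ` under the context `Nⁿ`. -/
theorem cbn_one_step_simulation (t u : LT) (N : LCtx) (R : NRule)
    (h : NStepAt R N t u) :
    StepAt (embNRule R) (embNC N) (embN t) (embN u) := by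
  obtain ⟨a, b, hab, rfl, rfl⟩ := h
  exact ⟨embN a, embN b, embN_root hab, embN_fill N a, embN_fill N b⟩

end BangPaper
end

section
/- (CBN surface context stability.) (1) (CBN → λ!) If N is a CBN surface context, then the embedded context Nⁿ is a surface context of λ!. (2) (λ! → CBN) If S is a surface context of λ! and F is a CBN full context such that Fⁿ = S, then F is a CBN surface context. -/
namespace BangPaper

/-- A CBN context is surface exactly when its embedding is a surface context of λ!. -/
theorem surface_embNC_iff (F : LCtx) : (embNC F).Surface ↔ F.NSurface := by
  induction F <;> simp_all [embNC, Ctx.Surface, LCtx.NSurface]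

/-- **CBN surface context stability.**
(1) If `N` is a CBN surface context then `Nⁿ` is a surface context of λ!.
(2) If `S` is a surface context of λ! and `F` a CBN full context with `Fⁿ = S`,
then `F` is a CBN surface context. -/
theorem cbn_surface_context_stability :
    (∀ N : LCtx, N.NSurface → (embNC N).Surface) ∧
    (∀ (S : Ctx) (F : LCtx), S.Surface → embNC F = S → F.NSurface) := by
  refine ⟨fun N hN => (surface_embNC_iff N).2 hN, ?_⟩
  rintro _ F hS rfl
  exact (surface_embNC_iff F).1 hS

end BangPaper
end
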